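/- Let n ≥ 1, −n < a < +∞, 1 ≤ p < +∞ and C_n > 0, and suppose u ∈ C(cl(ℝⁿ₊)) is a nonnegative solution of u(x) = ∫_{ℝⁿ₊} G⁺(x,y) |y|^a u(y)^p dy on ℝⁿ₊. Then for every λ > 0 and every x ∈ ℝⁿ₊ with x ≠ 0, the Kelvin-type transform u_λ(x) := u(λ²x/|x|²) satisfies u_λ(x) = ∫_{ℝⁿ₊} G⁺(x, y^λ) |y|^a u(y)^p dy, where y^λ := λ² y/|y|². -/

import Mathlib

open MeasureTheory Real Set Metric

noncomputable section

abbrev E (n : ℕ) := EuclideanSpace ℝ (Fin n)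

/-- The last coordinate `xₙ` of a point `x ∈ ℝⁿ` (junk value `0` when `n = 0`). -/
def lastCoord (n : ℕ) (x : E n) : ℝ :=
  if h : 0 < n then x ⟨n - 1, Nat.sub_lt h Nat.one_pos⟩ else 0

/-- The upper half space `ℝⁿ₊ = {x : xₙ > 0}`. -/
def halfSpace (n : ℕ) : Set (E n) := {x | 0 < lastCoord n x}

/-- The last standard basis vector `eₙ`. -/
def lastBasis (n : ℕ) : E n :=
  if h : 0 < n then EuclideanSpace.single ⟨n - 1, Nat.sub_lt h Nat.one_pos⟩ (1 : ℝ) else 0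

/-- The reflection `x̄ = (x₁, …, x_{n−1}, −xₙ)` of `x` across `∂ℝⁿ₊`. -/
def reflect (n : ℕ) (x : E n) : E n := x - (2 * lastCoord n x) • lastBasis n

/-- The kernel `G⁺(x,y) = C_n (ln(1/|x−y|) − ln(1/|x̄−y|))`, the Green function of
`(−Δ)^{n/2}` on the half space with Navier boundary conditions. -/
def Gplus (n : ℕ) (Cn : ℝ) (x y : E n) : ℝ :=
  Cn * (Real.log (1 / ‖x - y‖) - Real.log (1 / ‖reflect n x - y‖))

/-- The Laplacian `Δu = ∑ᵢ ∂²u/∂xᵢ²`. -/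
def lap (n : ℕ) (u : E n → ℝ) (x : E n) : ℝ :=
  ∑ i, fderiv ℝ (fun y => fderiv ℝ u y (EuclideanSpace.single i 1)) x
    (EuclideanSpace.single i 1)

/-- The iterate `(−Δ)^k u` of the negative Laplacian. -/
def negLapIter (n k : ℕ) (u : E n → ℝ) : E n → ℝ :=
  (fun v x => - lap n v x)^[k] u

/-- Points related by an inversion in the sphere of radius `l` centred at `0`. -/
lemma norm_mul_norm_inversion_sub {F : Type*} [NormedAddCommGroup F] [InnerProductSpace ℝ F]
    (l : ℝ) {x y : F} (hx : x ≠ 0) (hy : y ≠ 0) :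
    ‖x‖ * ‖(l ^ 2 / ‖x‖ ^ 2) • x - y‖ = ‖y‖ * ‖x - (l ^ 2 / ‖y‖ ^ 2) • y‖ := by
  have hx' : ‖x‖ ≠ 0 := norm_ne_zero_iff.mpr hx
  have hy' : ‖y‖ ≠ 0 := norm_ne_zero_iff.mpr hy
  rw [← sq_eq_sq₀ (by positivity) (by positivity), mul_pow, mul_pow, norm_sub_sq_real,
    norm_sub_sq_real, real_inner_smul_left, real_inner_smul_right, norm_smul, norm_smul,
    mul_pow, mul_pow, Real.norm_eq_abs, Real.norm_eq_abs, sq_abs, sq_abs]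
  field_simp
  ring

lemma lastCoord_smul (n : ℕ) (c : ℝ) (x : E n) : lastCoord n (c • x) = c * lastCoord n x := by
  unfold lastCoord
  split_ifs <;> simp

lemma reflect_smul (n : ℕ) (c : ℝ) (x : E n) : reflect n (c • x) = c • reflect n x := by
  simp only [reflect, lastCoord_smul, smul_sub, smul_smul]
  congr 2
  ring

lemma norm_reflect (n : ℕ) (x : E n) : ‖reflect n x‖ = ‖x‖ := by
  rw [← sq_eq_sq₀ (norm_nonneg _) (norm_nonneg _), reflect, norm_sub_sq_real,
    real_inner_smul_right, norm_smul, mul_pow, Real.norm_eq_abs, sq_abs]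
  unfold lastCoord lastBasis
  split_ifs
  · rw [EuclideanSpace.inner_single_right, PiLp.norm_single]
    simp
    ring
  · simp

lemma lastCoord_reflect {n : ℕ} (hn : 1 ≤ n) (x : E n) :
    lastCoord n (reflect n x) = -lastCoord n x := by
  have h : 0 < n := hn
  simp only [reflect, lastCoord, lastBasis, h, dif_pos, PiLp.sub_apply, PiLp.smul_apply,
    PiLp.single_apply, if_true, smul_eq_mul]
  ring

lemma ne_zero_of_mem_halfSpace {n : ℕ} {x : E n} (hx : x ∈ halfSpace n) : x ≠ 0 := by
  rintro rfl
  have h : 0 < lastCoord n 0 := hx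
  simp [lastCoord] at h

lemma smul_mem_halfSpace {n : ℕ} {c : ℝ} (hc : 0 < c) {x : E n} (hx : x ∈ halfSpace n) :
    c • x ∈ halfSpace n := by
  change 0 < lastCoord n (c • x)
  rw [lastCoord_smul]
  exact mul_pos hc hx

/-- The inversion moves from one argument of `Gplus` to the other, off the singularity. -/
lemma Gplus_inversion {n : ℕ} (hn : 1 ≤ n) (Cn l : ℝ) {x y : E n}
    (hx : x ∈ halfSpace n) (hy : y ∈ halfSpace n) (hxy : y ≠ (l ^ 2 / ‖x‖ ^ 2) • x) :
    Gplus n Cn ((l ^ 2 / ‖x‖ ^ 2) • x) y = Gplus n Cn x ((l ^ 2 / ‖y‖ ^ 2) • y) := by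
  have hx0 := ne_zero_of_mem_halfSpace hx
  have hy0 := ne_zero_of_mem_halfSpace hy
  have hxn : ‖x‖ ≠ 0 := norm_ne_zero_iff.mpr hx0
  have hyn : ‖y‖ ≠ 0 := norm_ne_zero_iff.mpr hy0
  have hr0 : reflect n x ≠ 0 := by
    rwa [← norm_ne_zero_iff, norm_reflect]
  have h₁ := norm_mul_norm_inversion_sub l hx0 hy0
  have h₂ := norm_mul_norm_inversion_sub l hr0 hy0
  rw [norm_reflect, ← reflect_smul] at h₂
  have hA : ‖(l ^ 2 / ‖x‖ ^ 2) • x - y‖ ≠ 0 :=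
    norm_ne_zero_iff.mpr (sub_ne_zero.mpr hxy.symm)
  have hB : ‖reflect n ((l ^ 2 / ‖x‖ ^ 2) • x) - y‖ ≠ 0 := by
    rw [norm_ne_zero_iff, sub_ne_zero]
    intro h
    have hy' : 0 < lastCoord n y := hy
    have hx' : 0 < lastCoord n x := hx
    rw [← h, lastCoord_reflect hn, lastCoord_smul] at hy'
    have : 0 ≤ l ^ 2 / ‖x‖ ^ 2 * lastCoord n x := by positivity
    linarith
  have hC : ‖x - (l ^ 2 / ‖y‖ ^ 2) • y‖ ≠ 0 := fun h => by simp [h, hxn, hA] at h₁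
  have hD : ‖reflect n x - (l ^ 2 / ‖y‖ ^ 2) • y‖ ≠ 0 := fun h => by simp [h, hxn, hB] at h₂
  have e₁ := congrArg Real.log h₁
  have e₂ := congrArg Real.log h₂
  rw [Real.log_mul hxn hA, Real.log_mul hyn hC] at e₁
  rw [Real.log_mul hxn hB, Real.log_mul hyn hD] at e₂
  simp only [Gplus, one_div, Real.log_inv]
  congr 1
  linarith

/-- **Integral equation for the Kelvin transform** (formula (4.4) of the paper).
If `u ∈ C(cl ℝⁿ₊)` is a nonnegative solution of `u(x) = ∫_{ℝⁿ₊} G⁺(x,y)|y|^a u(y)^p dy`,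
then for every `λ > 0` and every `x ∈ ℝⁿ₊` the Kelvin-type transform
`u_λ(x) = u(λ²x/|x|²)` satisfies `u_λ(x) = ∫_{ℝⁿ₊} G⁺(x,y^λ)|y|^a u(y)^p dy`, where
`y^λ = λ²y/|y|²`. -/
theorem kelvin_transform_IE (n : ℕ) (hn : 1 ≤ n) (a p Cn : ℝ)
    (ha : -(n : ℝ) < a) (hp : 1 ≤ p) (hCn : 0 < Cn)
    (u : E n → ℝ)
    (hu : ContinuousOn u (closure (halfSpace n)))
    (hnonneg : ∀ x ∈ closure (halfSpace n), 0 ≤ u x)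
    (hie : ∀ x ∈ halfSpace n,
      u x = ∫ y in halfSpace n, Gplus n Cn x y * ‖y‖ ^ a * u y ^ p) :
    ∀ lam : ℝ, 0 < lam → ∀ x ∈ halfSpace n,
      u ((lam ^ 2 / ‖x‖ ^ 2) • x) =
        ∫ y in halfSpace n,
          Gplus n Cn x ((lam ^ 2 / ‖y‖ ^ 2) • y) * ‖y‖ ^ a * u y ^ p := by
  intro lam hlam x hx
  have hxn : 0 < ‖x‖ := norm_pos_iff.mpr (ne_zero_of_mem_halfSpace hx)
  rw [hie _ (smul_mem_halfSpace (by positivity) hx)]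
  have : Nonempty (Fin n) := ⟨⟨0, hn⟩⟩
  have hae : ∀ᵐ y ∂(volume : Measure (E n)), y ≠ (lam ^ 2 / ‖x‖ ^ 2) • x := by
    simp [ae_iff]
  have hmeas : MeasurableSet (halfSpace n) := by
    refine measurableSet_lt measurable_const ?_
    unfold lastCoord
    split_ifs <;> fun_prop
  refine setIntegral_congr_ae hmeas ?_
  filter_upwards [hae] with y hy hyH
  rw [Gplus_inversion hn Cn lam hx hyH hy]
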